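/- arXiv:2203.09225 — 3 statements merged into one kernel-verified Lean document; each statement's English description precedes it below -/
import Mathlib

section
/- Let F = ⟨W, (Choice_i)_{i∈Ags}⟩ be an osstit frame. F satisfies the independence-of-agents property (ind) if and only if for all agents a, b ∈ Ags, all propositional variables p, q ∈ Var, and (equivalently, for all L_osstit-formulas φ, ψ), the formula [a]p ∧ [b]q → ◇(p ∧ q) is validated by F. -/
/-- Formulas of the language L_osstit. -/
inductive Formula (Agent : Type) : Type
  | var : ℕ → Formula Agent
  | neg : Formula Agent → Formula Agent
  | or : Formula Agent → Formula Agent → Formula Agent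
  | box : Formula Agent → Formula Agent
  | ag : Agent → Formula Agent → Formula Agent
  | eAg : Agent → Formula Agent → Formula Agent

namespace Formula
def and {Agent : Type} (φ ψ : Formula Agent) : Formula Agent := .neg (.or (.neg φ) (.neg ψ))
def imp {Agent : Type} (φ ψ : Formula Agent) : Formula Agent := .or (.neg φ) ψ
def diamond {Agent : Type} (φ : Formula Agent) : Formula Agent := .neg (.box (.neg φ))
def iffF {Agent : Type} (φ ψ : Formula Agent) : Formula Agent := (φ.imp ψ).and (ψ.imp φ)
end Formula

/-- One-shot strategic stit (osstit) frame. -/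
structure Frame (Agent : Type) where
  W : Type
  nonempty : Nonempty W
  Choice : Agent → W → Set (Set W)
  mono : ∀ i w X Y, X ∈ Choice i w → X ⊆ Y → Y ∈ Choice i w
  empty_not_mem : ∀ i w, ∅ ∉ Choice i w
  univ_mem : ∀ i w, Set.univ ∈ Choice i w

/-- Non-monotonic core of the neighbourhood `Choice i w`. -/
def core {Agent : Type} (F : Frame Agent) (i : Agent) (w : F.W) : Set (Set F.W) :=
  {X | X ∈ F.Choice i w ∧ ¬ ∃ Y ∈ F.Choice i w, Y ⊂ X}

/-- Satisfaction in an osstit model `⟨F, V⟩`. -/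
def sat {Agent : Type} (F : Frame Agent) (V : ℕ → Set F.W) : F.W → Formula Agent → Prop
  | w, .var n => w ∈ V n
  | w, .neg φ => ¬ sat F V w φ
  | w, .or φ ψ => sat F V w φ ∨ sat F V w ψ
  | _, .box φ => ∀ w', sat F V w' φ
  | w, .ag i φ => {w' | sat F V w' φ} ∈ F.Choice i w
  | w, .eAg i φ => ∀ X ∈ core F i w, ∀ w' ∈ X, sat F V w' φ

/-- Frame validity. -/
def valid {Agent : Type} (F : Frame Agent) (φ : Formula Agent) : Prop :=
  ∀ (V : ℕ → Set F.W) (w : F.W), sat F V w φ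

/-- Independence of agents (ind). -/
def ind {Agent : Type} (F : Frame Agent) : Prop :=
  ∀ (w : F.W) (a b : Agent) (X Y : Set F.W),
    X ∈ F.Choice a w → Y ∈ F.Choice b w → (X ∩ Y).Nonempty

theorem sat_imp_iff {Agent : Type} (F : Frame Agent) (V : ℕ → Set F.W) (w : F.W)
    (φ ψ : Formula Agent) :
    sat F V w (φ.imp ψ) ↔ (sat F V w φ → sat F V w ψ) := by
  simp only [Formula.imp, sat]
  tauto

theorem sat_and_iff {Agent : Type} (F : Frame Agent) (V : ℕ → Set F.W) (w : F.W)
    (φ ψ : Formula Agent) :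
    sat F V w (φ.and ψ) ↔ sat F V w φ ∧ sat F V w ψ := by
  simp only [Formula.and, sat]
  tauto

theorem sat_diamond_iff {Agent : Type} (F : Frame Agent) (V : ℕ → Set F.W) (w : F.W)
    (φ : Formula Agent) :
    sat F V w φ.diamond ↔ ∃ w', sat F V w' φ := by
  simp only [Formula.diamond, sat, not_forall, not_not]

/-- Independence validates the independence schema for arbitrary formulas. -/
theorem ind.valid_schema {Agent : Type} {F : Frame Agent} (h : ind F) (a b : Agent)
    (φ ψ : Formula Agent) :
    valid F (((Formula.ag a φ).and (Formula.ag b ψ)).imp ((φ.and ψ).diamond)) := by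
  intro V w
  rw [sat_imp_iff, sat_and_iff, sat_diamond_iff]
  rintro ⟨hφ, hψ⟩
  obtain ⟨v, hv⟩ := h w a b _ _ hφ hψ
  exact ⟨v, (sat_and_iff F V v φ ψ).2 hv⟩

/-- Validity of the independence schema for two distinct variables implies independence. -/
theorem ind_of_valid_var {Agent : Type} {F : Frame Agent} {p q : ℕ} (hpq : p ≠ q)
    (h : ∀ a b : Agent, valid F (((Formula.ag a (.var p)).and (Formula.ag b (.var q))).imp
      (((Formula.var p).and (Formula.var q)).diamond))) : ind F := by
  intro w a b X Y hX hY
  have hs := h a b (fun n => if n = p then X else Y) w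
  rw [sat_imp_iff, sat_and_iff, sat_diamond_iff] at hs
  simp only [sat_and_iff, sat, if_true, if_neg hpq.symm] at hs
  exact hs ⟨hX, hY⟩

/-- F satisfies (ind) iff, for all agents a, b and all propositional
variables p, q (equivalently, all formulas φ, ψ), F validates [a]p ∧ [b]q → ◇(p ∧ q). -/
theorem stmt0 {Agent : Type} (F : Frame Agent) :
    (ind F ↔ ∀ (a b : Agent) (p q : ℕ),
      valid F (((Formula.ag a (.var p)).and (Formula.ag b (.var q))).imp
        (((Formula.var p).and (Formula.var q)).diamond)))
    ∧
    (ind F ↔ ∀ (a b : Agent) (φ ψ : Formula Agent),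
      valid F (((Formula.ag a φ).and (Formula.ag b ψ)).imp ((φ.and ψ).diamond))) := by
  exact
    ⟨⟨fun h a b p q => h.valid_schema a b (.var p) (.var q),
        fun h => ind_of_valid_var zero_ne_one fun a b => h a b 0 1⟩,
      ⟨fun h => h.valid_schema,
        fun h => ind_of_valid_var zero_ne_one fun a b => h a b (.var 0) (.var 1)⟩⟩
end

section
/- Let F = ⟨W, (Choice_i)_{i∈Ags}⟩ be an osstit frame and let i ∈ Ags. F satisfies property (nec) for i if and only if for all propositional variables p (equivalently, all L_osstit-formulas φ) the formula [i]p → □[i]p is validated by F. -/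
/-- Property (nec) for agent i. -/
def nec {Agent : Type} (F : Frame Agent) (i : Agent) : Prop :=
  ∀ (w w' : F.W) (X : Set F.W), X ∈ F.Choice i w → X ∈ F.Choice i w'

theorem valid_ag_imp_box_of_nec {Agent : Type} {F : Frame Agent} {i : Agent} (h : nec F i)
    (φ : Formula Agent) : valid F ((Formula.ag i φ).imp ((Formula.ag i φ).box)) := by
  intro V w
  simp only [Formula.imp, sat]
  exact or_iff_not_imp_left.mpr fun hw w' => h w w' _ (not_not.mp hw)

theorem nec_of_valid_ag_var_imp_box {Agent : Type} {F : Frame Agent} {i : Agent} {p : ℕ}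
    (h : valid F ((Formula.ag i (.var p)).imp ((Formula.ag i (.var p)).box))) : nec F i := by
  intro w w' X hX
  have hw := h (fun _ => X) w
  simp only [Formula.imp, sat, Set.ofPred_mem_eq] at hw
  exact hw.resolve_left (not_not.mpr hX) w'

/-- F satisfies (nec) for i iff, for all propositional variables p
(equivalently, all formulas φ), F validates [i]p → □[i]p. -/
theorem stmt2 {Agent : Type} (F : Frame Agent) (i : Agent) :
    (nec F i ↔ ∀ p : ℕ,
      valid F ((Formula.ag i (.var p)).imp ((Formula.ag i (.var p)).box)))
    ∧
    (nec F i ↔ ∀ φ : Formula Agent,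
      valid F ((Formula.ag i φ).imp ((Formula.ag i φ).box))) := by
  exact ⟨⟨fun h p => valid_ag_imp_box_of_nec h (.var p),
      fun h => nec_of_valid_ag_var_imp_box (h 0)⟩,
    ⟨valid_ag_imp_box_of_nec, fun h => nec_of_valid_ag_var_imp_box (h (.var 0))⟩⟩
end

section
/- Let F = ⟨W, (Choice_i)_{i∈Ags}⟩ be an osstit frame and let i ∈ Ags. F satisfies property (un) for i if and only if for all propositional variables p (equivalently, all L_osstit-formulas φ) the formula □p ↔ [∃_i]p is validated by F. -/
/-- Property (un) for agent i: the non-monotonic core covers W at every state. -/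
def un {Agent : Type} (F : Frame Agent) (i : Agent) : Prop :=
  ∀ w : F.W, ⋃₀ core F i w = Set.univ

theorem sat_iffF {Agent : Type} (F : Frame Agent) (V : ℕ → Set F.W) (w : F.W)
    (φ ψ : Formula Agent) : sat F V w (φ.iffF ψ) ↔ (sat F V w φ ↔ sat F V w ψ) := by
  simp only [Formula.iffF, Formula.and, Formula.imp, sat]
  tauto

theorem un.valid_box_iffF_eAg {Agent : Type} {F : Frame Agent} {i : Agent} (h : un F i)
    (φ : Formula Agent) : valid F (φ.box.iffF (.eAg i φ)) := by
  intro V w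
  rw [sat_iffF]
  simp only [sat]
  refine ⟨fun hφ _ _ w' _ => hφ w', fun hφ w' => ?_⟩
  obtain ⟨X, hX, hw'⟩ : w' ∈ ⋃₀ core F i w := h w ▸ Set.mem_univ w'
  exact hφ X hX w' hw'

theorem un_of_valid_var {Agent : Type} {F : Frame Agent} {i : Agent} (p : ℕ)
    (h : valid F ((Formula.var p).box.iffF (.eAg i (.var p)))) : un F i := by
  intro w
  have hw := (sat_iffF F _ w _ _).mp (h (fun _ => ⋃₀ core F i w) w)
  simp only [sat] at hw
  exact Set.eq_univ_of_forall (hw.mpr fun X hX w' hw' => ⟨X, hX, hw'⟩)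

/-- F satisfies (un) for i iff, for all propositional variables p
(equivalently, all formulas φ), F validates □p ↔ [∃_i]p. -/
theorem stmt4 {Agent : Type} (F : Frame Agent) (i : Agent) :
    (un F i ↔ ∀ p : ℕ,
      valid F (((Formula.var p).box).iffF (Formula.eAg i (.var p))))
    ∧
    (un F i ↔ ∀ φ : Formula Agent,
      valid F ((φ.box).iffF (Formula.eAg i φ))) :=
  ⟨⟨fun h p => h.valid_box_iffF_eAg (.var p), fun h => un_of_valid_var 0 (h 0)⟩,
    ⟨fun h φ => h.valid_box_iffF_eAg φ, fun h => un_of_valid_var 0 (h (.var 0))⟩⟩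
end
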